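/- Let μ be a finite Borel measure on ℝ, μ̂(t) = ∫ e^{-itλ} dμ(λ) its Fourier transform, and β > 0. Then the function λ ↦ e^{βλ} belongs to L¹(μ) if and only if there exists a function F, holomorphic in the open strip S_β = {z ∈ ℂ : 0 < Im z < β} and continuous on its closure, whose boundary value on ℝ is μ̂ (i.e. F(t) = μ̂(t) for all t ∈ ℝ). Moreover, in this case F is automatically bounded on the closed strip. -/

import Mathlib

open MeasureTheory

section Aux
open Complex Set

lemma glue_aux (g : ℂ → ℂ) (β : ℝ) (hβ : 0 < β)
    (hc : ContinuousOn g {s : ℂ | s.re < β})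
    (h1 : DifferentiableOn ℂ g {s : ℂ | s.re < 0})
    (h2 : DifferentiableOn ℂ g {s : ℂ | 0 < s.re ∧ s.re < β}) :
    DifferentiableOn ℂ g {s : ℂ | s.re < β} := by
  have hU : IsOpen {s : ℂ | s.re < β} := isOpen_lt continuous_re continuous_const
  rw [← isConservativeOn_and_continuousOn_iff_isDifferentiableOn hU]
  refine ⟨?_, hc⟩
  intro z w hzw
  have hz : z.re < β := hzw (by simp [Rectangle, mem_reProdIm])
  have hw : w.re < β := hzw (by simp [Rectangle, mem_reProdIm])
  have key : ∀ z w : ℂ, z.re < β → w.re < β → (z.re = 0 ∨ w.re = 0) →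
      (∫ x : ℝ in z.re..w.re, g (x + z.im * I)) - (∫ x : ℝ in z.re..w.re, g (x + w.im * I)) +
      I • (∫ y : ℝ in z.im..w.im, g (re w + y * I)) -
      I • (∫ y : ℝ in z.im..w.im, g (re z + y * I)) = 0 := by
    intro z w hz hw h0
    apply integral_boundary_rect_eq_zero_of_continuousOn_of_differentiableOn
    · refine hc.mono ?_
      intro s hs
      have := (mem_reProdIm.1 hs).1
      rw [mem_uIcc] at this
      show s.re < β
      rcases this with h | h <;> linarith
    · intro s hs
      have := (mem_reProdIm.1 hs).1
      rw [mem_Ioo, min_lt_iff, lt_max_iff] at this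
      have hlt : s.re < 0 ∨ (0 < s.re ∧ s.re < β) := by grind
      rcases hlt with h | h
      · exact (h1.differentiableAt ((isOpen_lt continuous_re continuous_const).mem_nhds h)).differentiableWithinAt
      · refine (h2.differentiableAt (IsOpen.mem_nhds ?_ h)).differentiableWithinAt
        exact (isOpen_lt continuous_const continuous_re).inter hU
  rw [← add_eq_zero_iff_eq_neg, wedgeIntegral_add_wedgeIntegral_eq]
  have k1 := key z (w.im * I) hz (by simpa) (by simp)
  have k2 := key (z.im * I) w (by simpa) hw (by simp)
  have hint : ∀ b a c : ℝ, a < β → c < β →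
      IntervalIntegrable (fun x : ℝ => g (x + b * I)) volume a c := by
    intro b a c ha hcc
    apply ContinuousOn.intervalIntegrable
    refine hc.comp (by fun_prop) ?_
    intro x hx
    rw [mem_uIcc] at hx
    simp
    grind
  have e1 := intervalIntegral.integral_add_adjacent_intervals (hint z.im _ _ hz hβ) (hint z.im _ _ hβ hw)
  have e2 := intervalIntegral.integral_add_adjacent_intervals (hint w.im _ _ hz hβ) (hint w.im _ _ hβ hw)
  rw [← e1, ← e2]
  simp at k1 k2 ⊢
  linear_combination k1 + k2

lemma int_aux (ν : Measure ℝ) [IsFiniteMeasure ν] (s : ℝ) (h : ∀ᵐ x ∂ν, s * x ≤ 0) :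
    Integrable (fun x : ℝ => Real.exp (s * x)) ν := by
  refine Integrable.mono' (integrable_const (1:ℝ)) (by fun_prop) ?_
  filter_upwards [h] with x hx
  rw [Real.norm_eq_abs, abs_of_pos (Real.exp_pos _)]
  exact Real.exp_le_one_iff.2 hx

lemma cont_aux (ν : Measure ℝ) (S : Set ℂ) (b : ℝ → ℝ) (hb : Integrable b ν)
    (h : ∀ s ∈ S, ∀ᵐ x ∂ν, Real.exp (s.re * x) ≤ b x) :
    ContinuousOn (ProbabilityTheory.complexMGF id ν) S := by
  unfold ProbabilityTheory.complexMGF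
  refine continuousOn_of_dominated (bound := b) ?_ ?_ hb ?_
  · intro s _
    exact (by fun_prop : Continuous fun x : ℝ => cexp (s * (id x : ℝ))).aestronglyMeasurable
  · intro s hs
    filter_upwards [h s hs] with x hx
    rw [norm_exp]
    simpa using hx
  · filter_upwards with x
    fun_prop

lemma half_bound (c x s : ℝ) (h0 : 0 ≤ s) (h1 : s ≤ c) : Real.exp (s * x) ≤ 1 + Real.exp (c * x) := by
  rcases le_total x 0 with h | h
  · have : Real.exp (s * x) ≤ 1 := Real.exp_le_one_iff.2 (mul_nonpos_of_nonneg_of_nonpos h0 h)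
    linarith [Real.exp_pos (c * x)]
  · have : Real.exp (s * x) ≤ Real.exp (c * x) := by gcongr
    linarith

lemma mono_aux (ν : Measure ℝ) [IsFiniteMeasure ν] (c s : ℝ) (h0 : 0 ≤ s) (h1 : s ≤ c)
    (h : Integrable (fun x : ℝ => Real.exp (c * x)) ν) :
    Integrable (fun x : ℝ => Real.exp (s * x)) ν := by
  refine Integrable.mono' ((integrable_const (1:ℝ)).add h) (by fun_prop) ?_
  filter_upwards with x
  rw [Real.norm_eq_abs, abs_of_pos (Real.exp_pos _)]
  exact half_bound c x s h0 h1

lemma pringsheim_aux (ν : Measure ℝ) [IsFiniteMeasure ν] (hν : ∀ᵐ x ∂ν, 0 ≤ x) (β : ℝ)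
    (g : ℂ → ℂ) (hg : DifferentiableOn ℂ g {s : ℂ | s.re < β})
    (hgν : ∀ s : ℂ, s.re < 0 → g s = ProbabilityTheory.complexMGF id ν s)
    (s : ℝ) (hs0 : 0 ≤ s) (hs : s < β) :
    Integrable (fun x : ℝ => Real.exp (s * x)) ν := by
  have hint : (-1 : ℝ) ∈ interior (ProbabilityTheory.integrableExpSet id ν) := by
    rw [mem_interior]
    refine ⟨Iio 0, ?_, isOpen_Iio, by simp⟩
    intro t ht
    refine int_aux ν t ?_
    filter_upwards [hν] with x hx
    exact mul_nonpos_of_nonpos_of_nonneg (le_of_lt ht) hx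
  have hball : Metric.ball (-1 : ℂ) (β + 1) ⊆ {s : ℂ | s.re < β} := by
    intro z hz
    rw [mem_ball_iff_norm] at hz
    have := (abs_le.1 (abs_re_le_norm (z - -1))).2
    simp at this
    show z.re < β
    simp at hz
    linarith
  have hsb : (s : ℂ) ∈ Metric.ball (-1 : ℂ) (β + 1) := by
    rw [mem_ball_iff_norm, show (s : ℂ) - -1 = ((s + 1 : ℝ) : ℂ) by push_cast; ring, norm_real,
      Real.norm_eq_abs, abs_of_nonneg (by linarith)]
    linarith
  have hS := (Complex.hasSum_taylorSeries_on_ball (hg.mono hball) hsb).summable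
  have hder : ∀ n : ℕ, iteratedDeriv n g (-1) =
      ((∫ x : ℝ, x ^ n * Real.exp (-1 * x) ∂ν : ℝ) : ℂ) := by
    intro n
    have he : g =ᶠ[nhds (-1)] ProbabilityTheory.complexMGF id ν := by
      filter_upwards [(isOpen_lt continuous_re continuous_const).mem_nhds
        (show (-1 : ℂ) ∈ {s : ℂ | s.re < 0} by simp)] with z hz using hgν z hz
    rw [he.iteratedDeriv_eq, ProbabilityTheory.iteratedDeriv_complexMGF (by simpa using hint),
      ← integral_complex_ofReal]
    simp
  have hfi : ∀ n : ℕ, Integrable (fun x : ℝ => x ^ n * Real.exp (-1 * x)) ν := fun n =>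
    ProbabilityTheory.integrable_pow_mul_exp_of_mem_interior_integrableExpSet hint n
  set f : ℕ → ℝ → ℝ := fun n x => (n.factorial : ℝ)⁻¹ * (s + 1) ^ n * (x ^ n * Real.exp (-1 * x))
    with hf
  have hfi' : ∀ n, Integrable (f n) ν := fun n => (hfi n).const_mul _
  have hsum : Summable fun n => ∫ x, f n x ∂ν := by
    rw [← Complex.summable_ofReal]
    refine hS.congr ?_
    intro n
    rw [hder, hf]
    simp only [integral_const_mul]
    push_cast
    simp [smul_eq_mul]
    ring
  have hpt : ∀ x, HasSum (fun n => f n x) (Real.exp (s * x)) := by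
    intro x
    have := (NormedSpace.expSeries_div_hasSum_exp (𝔸 := ℝ) ((s + 1) * x)).mul_right (Real.exp (-1 * x))
    rw [← Real.exp_eq_exp_ℝ, ← Real.exp_add] at this
    convert! this using 1
    · ext n
      simp only [hf, mul_pow]
      ring
    · congr 1; ring
  have hnn : ∀ᵐ x ∂ν, ∀ n, 0 ≤ f n x := by
    filter_upwards [hν] with x hx n
    simp only [hf]
    positivity
  refine ⟨by fun_prop, ?_⟩
  rw [hasFiniteIntegral_iff_ofReal (by filter_upwards with x using (Real.exp_pos _).le)]
  have e1 : ∫⁻ x, ENNReal.ofReal (Real.exp (s * x)) ∂ν = ∫⁻ x, ∑' n, ENNReal.ofReal (f n x) ∂ν := by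
    refine lintegral_congr_ae ?_
    filter_upwards [hnn] with x hx
    rw [← ENNReal.ofReal_tsum_of_nonneg hx (hpt x).summable, (hpt x).tsum_eq]
  rw [e1, lintegral_tsum (fun n => (hfi' n).aemeasurable.ennreal_ofReal)]
  have e2 : ∀ n, ∫⁻ x, ENNReal.ofReal (f n x) ∂ν = ENNReal.ofReal (∫ x, f n x ∂ν) := fun n =>
    (ofReal_integral_eq_lintegral_ofReal (hfi' n) (by filter_upwards [hnn] with x hx using hx n)).symm
  simp_rw [e2]
  rw [← ENNReal.ofReal_tsum_of_nonneg (fun n => integral_nonneg_of_ae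
    (by filter_upwards [hnn] with x hx using hx n)) hsum]
  exact ENNReal.ofReal_lt_top

lemma mgf_eq_aux (ν : Measure ℝ) [IsFiniteMeasure ν] (hν : ∀ᵐ x ∂ν, 0 ≤ x) (β : ℝ) (hβ : 0 < β)
    (g : ℂ → ℂ) (hg : DifferentiableOn ℂ g {s : ℂ | s.re < β})
    (hgν : ∀ s : ℂ, s.re < 0 → g s = ProbabilityTheory.complexMGF id ν s) :
    ∀ s : ℂ, s.re < β → g s = ProbabilityTheory.complexMGF id ν s := by
  have hU : IsOpen {s : ℂ | s.re < β} := isOpen_lt continuous_re continuous_const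
  have hsub : Iio β ⊆ interior (ProbabilityTheory.integrableExpSet id ν) := by
    rw [isOpen_Iio.subset_interior_iff]
    intro t ht
    rcases le_total 0 t with h | h
    · exact pringsheim_aux ν hν β g hg hgν t h ht
    · refine int_aux ν t ?_
      filter_upwards [hν] with x hx
      exact mul_nonpos_of_nonpos_of_nonneg h hx
  have h2 : DifferentiableOn ℂ (ProbabilityTheory.complexMGF id ν) {s : ℂ | s.re < β} :=
    ProbabilityTheory.differentiableOn_complexMGF.mono fun s hs => hsub hs
  have := (hg.analyticOnNhd hU).eqOn_of_preconnected_of_eventuallyEq (h2.analyticOnNhd hU)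
    (convex_halfSpace_re_lt β).isPreconnected (z₀ := -1) (by simp; linarith) (by
      filter_upwards [(isOpen_lt continuous_re continuous_const).mem_nhds
        (show (-1 : ℂ) ∈ {s : ℂ | s.re < 0} by simp)] with z hz using hgν z hz)
  exact fun s hs => this hs

lemma core_aux (μ : Measure ℝ) [IsFiniteMeasure μ] (β : ℝ) (hβ : 0 < β) (F : ℂ → ℂ)
    (hd : DifferentiableOn ℂ F {z : ℂ | 0 < z.im ∧ z.im < β})
    (hc : ContinuousOn F {z : ℂ | 0 ≤ z.im ∧ z.im ≤ β})
    (hF : ∀ t : ℝ, F t = ∫ x : ℝ, Complex.exp (-(Complex.I * t * x)) ∂μ) :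
    Integrable (fun x : ℝ => Real.exp (β * x)) μ ∧
    ∃ C : ℝ, ∀ z ∈ {z : ℂ | 0 ≤ z.im ∧ z.im ≤ β}, ‖F z‖ ≤ C := by
  set νp := μ.restrict (Ici 0) with hνp
  set νm := μ.restrict (Ici 0)ᶜ with hνm
  have hp : ∀ᵐ x ∂νp, 0 ≤ x := ae_restrict_mem measurableSet_Ici
  have hm : ∀ᵐ x ∂νm, x ≤ 0 := by
    filter_upwards [ae_restrict_mem (μ := μ) (measurableSet_Ici (a := (0:ℝ))).compl] with x hx
    have hx' : x < 0 := by simpa using hx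
    exact hx'.le
  set Mp := ProbabilityTheory.complexMGF id νp with hMp
  set Mm := ProbabilityTheory.complexMGF id νm with hMm
  have hMpc : ContinuousOn Mp {s : ℂ | s.re ≤ 0} := by
    refine cont_aux νp _ (fun _ => 1) (integrable_const _) ?_
    intro s hs
    filter_upwards [hp] with x hx
    exact Real.exp_le_one_iff.2 (mul_nonpos_of_nonpos_of_nonneg hs hx)
  have hMmc : ContinuousOn Mm {s : ℂ | 0 ≤ s.re ∧ s.re ≤ β} := by
    refine cont_aux νm _ (fun _ => 1) (integrable_const _) ?_
    intro s hs
    filter_upwards [hm] with x hx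
    exact Real.exp_le_one_iff.2 (mul_nonpos_of_nonneg_of_nonpos hs.1 hx)
  have hMpd : DifferentiableOn ℂ Mp {s : ℂ | s.re < 0} := by
    refine ProbabilityTheory.differentiableOn_complexMGF.mono ?_
    have : Iio 0 ⊆ interior (ProbabilityTheory.integrableExpSet id νp) := by
      rw [isOpen_Iio.subset_interior_iff]
      intro t ht
      refine int_aux νp t ?_
      filter_upwards [hp] with x hx
      exact mul_nonpos_of_nonpos_of_nonneg (le_of_lt ht) hx
    exact fun s hs => this hs
  have hMmd : DifferentiableOn ℂ Mm {s : ℂ | 0 < s.re ∧ s.re < β} := by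
    refine ProbabilityTheory.differentiableOn_complexMGF.mono ?_
    have : Ioi 0 ⊆ interior (ProbabilityTheory.integrableExpSet id νm) := by
      rw [isOpen_Ioi.subset_interior_iff]
      intro t ht
      refine int_aux νm t ?_
      filter_upwards [hm] with x hx
      exact mul_nonpos_of_nonneg_of_nonpos (le_of_lt ht) hx
    exact fun s hs => this hs.1
  have hbd : ∀ s : ℂ, s.re = 0 → F (I * s) - Mm s = Mp s := by
    intro s hs
    have hs' : s = s.im * I := by apply Complex.ext <;> simp [hs]
    have h1 : I * s = ((-s.im : ℝ) : ℂ) := by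
      apply Complex.ext <;> simp [hs]
    have h2 : F (I * s) = ∫ x : ℝ, cexp (s * x) ∂μ := by
      rw [h1, hF]
      congr 1
      ext x
      congr 1
      conv_rhs => rw [hs']
      push_cast
      ring
    have h3 : Integrable (fun x : ℝ => cexp (s * x)) μ := by
      refine Integrable.mono' (integrable_const (1:ℝ)) ?_ ?_
      · exact (by fun_prop : Continuous fun x : ℝ => cexp (s * x)).aestronglyMeasurable
      · filter_upwards with x
        rw [norm_exp]
        simp [hs]
    rw [h2, ← integral_add_compl measurableSet_Ici h3, sub_eq_iff_eq_add]
    rfl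
  set g : ℂ → ℂ := fun s => if s.re < 0 then Mp s else F (I * s) - Mm s with hg
  have hg1 : EqOn g Mp {s : ℂ | s.re ≤ 0} := by
    intro s hs
    have hs' : s.re ≤ 0 := hs
    rcases lt_or_eq_of_le hs' with h | h
    · simp [hg, h]
    · simp only [hg, h, lt_irrefl, if_false]
      exact hbd s h
  have hg2 : EqOn g (fun s => F (I * s) - Mm s) {s : ℂ | 0 ≤ s.re} := by
    intro s hs
    have hs' : 0 ≤ s.re := hs
    simp only [hg, if_neg (not_lt.2 hs')]
  have hgc : ContinuousOn g {s : ℂ | s.re ≤ β} := by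
    have a1 : ContinuousOn g {s : ℂ | s.re ≤ 0} := hMpc.congr hg1
    have a2 : ContinuousOn g {s : ℂ | 0 ≤ s.re ∧ s.re ≤ β} := by
      refine ContinuousOn.congr (f := fun s => F (I * s) - Mm s) ?_ (hg2.mono fun s hs => hs.1)
      refine ContinuousOn.sub (hc.comp (by fun_prop) ?_) hMmc
      intro s hs
      simpa using hs
    have := a1.union_of_isClosed a2 (isClosed_le continuous_re continuous_const)
      ((isClosed_le continuous_const continuous_re).inter (isClosed_le continuous_re continuous_const))
    refine this.mono ?_
    intro s hs
    rcases le_total s.re 0 with h | h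
    · exact Or.inl h
    · exact Or.inr ⟨h, hs⟩
  have hgd : DifferentiableOn ℂ g {s : ℂ | s.re < β} := by
    refine glue_aux g β hβ (hgc.mono fun s (hs : s.re < β) => (le_of_lt hs : s.re ≤ β)) ?_ ?_
    · exact hMpd.congr fun s (hs : s.re < 0) => hg1 (le_of_lt hs : s.re ≤ 0)
    · refine DifferentiableOn.congr (f := fun s => F (I * s) - Mm s) ?_ (hg2.mono fun s hs => hs.1.le)
      refine DifferentiableOn.sub (hd.comp (by fun_prop) ?_) hMmd
      intro s hs
      simpa using hs
  have hgν : ∀ s : ℂ, s.re < 0 → g s = Mp s := fun s hs => hg1 (le_of_lt hs : s.re ≤ 0)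
  have hgM := mgf_eq_aux νp hp β hβ g hgd hgν
  obtain ⟨u, -, hu, hul⟩ := exists_seq_strictMono_tendsto' hβ
  have hIp : Integrable (fun x : ℝ => Real.exp (β * x)) νp := by
    refine integrable_of_tendsto (G := fun n x => Real.exp (u n * x)) ?_ ?_ ?_
    · filter_upwards with x
      exact (Real.continuous_exp.tendsto _).comp (hul.mul_const x)
    · intro n
      fun_prop
    · have e : ∀ n, ∫⁻ x, ‖Real.exp (u n * x)‖ₑ ∂νp = ENNReal.ofReal (g (u n)).re := by
        intro n
        have hi := pringsheim_aux νp hp β g hgd hgν (u n) (hu n).1.le (hu n).2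
        rw [← ofReal_integral_norm_eq_lintegral_enorm hi, hgM _ (by simpa using (hu n).2),
          ProbabilityTheory.re_complexMGF_ofReal]
        simp [ProbabilityTheory.mgf]
      have ht : Filter.Tendsto (fun n => ENNReal.ofReal (g (u n)).re) Filter.atTop
          (nhds (ENNReal.ofReal (g β).re)) := by
        refine ENNReal.tendsto_ofReal ((continuous_re.tendsto _).comp ?_)
        refine (hgc (β : ℂ) (by simp)).tendsto.comp ?_
        refine tendsto_nhdsWithin_iff.2 ⟨(continuous_ofReal.tendsto _).comp hul, ?_⟩
        filter_upwards with n
        simpa using (hu n).2.le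
      simp_rw [e]
      rw [ht.liminf_eq]
      exact ENNReal.ofReal_ne_top
  have hIm : Integrable (fun x : ℝ => Real.exp (β * x)) νm := by
    refine int_aux νm β ?_
    filter_upwards [hm] with x hx
    exact mul_nonpos_of_nonneg_of_nonpos hβ.le hx
  have bound : ∀ (ν : Measure ℝ) [IsFiniteMeasure ν],
      Integrable (fun x : ℝ => Real.exp (β * x)) ν → ∀ s : ℂ, 0 ≤ s.re → s.re ≤ β →
      ‖ProbabilityTheory.complexMGF id ν s‖ ≤ ∫ x, (1 + Real.exp (β * x)) ∂ν := by
    intro ν _ hi s h0 h1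
    refine ProbabilityTheory.norm_complexMGF_le_mgf.trans ?_
    refine integral_mono (mono_aux ν β s.re h0 h1 hi) ((integrable_const (1:ℝ)).add hi) ?_
    intro x
    exact half_bound β x s.re h0 h1
  refine ⟨?_, (∫ x, (1 + Real.exp (β * x)) ∂νp) + (∫ x, (1 + Real.exp (β * x)) ∂νm), ?_⟩
  · have : IntegrableOn (fun x : ℝ => Real.exp (β * x)) (Ici 0 ∪ (Ici 0)ᶜ) μ :=
      IntegrableOn.union hIp hIm
    rwa [union_compl_self, integrableOn_univ] at this
  have hlt : ∀ z : ℂ, 0 ≤ z.im → z.im < β →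
      ‖F z‖ ≤ (∫ x, (1 + Real.exp (β * x)) ∂νp) + (∫ x, (1 + Real.exp (β * x)) ∂νm) := by
    intro z h0 h1
    have hre : (-I * z).re = z.im := by simp
    have e1 := hg2 (x := -I * z) (by simpa using h0)
    have e2 := hgM (-I * z) (by simpa using h1)
    have e3 : I * (-I * z) = z := by rw [← mul_assoc, mul_neg, I_mul_I]; simp
    simp only [e3] at e1
    have e4 : F z = Mp (-I * z) + Mm (-I * z) := by
      rw [hMp, ← e2, e1]; ring
    rw [e4]
    refine (norm_add_le _ _).trans (add_le_add ?_ ?_)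
    · exact bound νp hIp _ (by rw [hre]; exact h0) (by rw [hre]; exact h1.le)
    · exact bound νm hIm _ (by rw [hre]; exact h0) (by rw [hre]; exact h1.le)
  intro z hz
  rcases lt_or_eq_of_le hz.2 with h | h
  · exact hlt z hz.1 h
  · have hzt : Filter.Tendsto (fun n => (z.re : ℂ) + u n * I) Filter.atTop
        (nhdsWithin z {z : ℂ | 0 ≤ z.im ∧ z.im ≤ β}) := by
      refine tendsto_nhdsWithin_iff.2 ⟨?_, ?_⟩
      · have : (z.re : ℂ) + (β : ℂ) * I = z := by rw [← h]; exact re_add_im z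
        conv => rhs; rw [← this]
        exact (((continuous_ofReal.tendsto _).comp hul).mul_const I).const_add _
      · filter_upwards with n
        simpa using ⟨(hu n).1.le, (hu n).2.le⟩
    refine le_of_tendsto ((hc z hz).tendsto.comp hzt).norm ?_
    filter_upwards with n
    exact hlt _ (by simpa using (hu n).1.le) (by simpa using (hu n).2)

lemma forward_aux (μ : Measure ℝ) [IsFiniteMeasure μ] (β : ℝ)
    (h : Integrable (fun x : ℝ => Real.exp (β * x)) μ) :
    ∃ F : ℂ → ℂ,
        DifferentiableOn ℂ F {z : ℂ | 0 < z.im ∧ z.im < β} ∧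
        ContinuousOn F {z : ℂ | 0 ≤ z.im ∧ z.im ≤ β} ∧
        (∀ t : ℝ, F t = ∫ x : ℝ, Complex.exp (-(Complex.I * t * x)) ∂μ) := by
  refine ⟨fun z => ProbabilityTheory.complexMGF id μ (-I * z), ?_, ?_, ?_⟩
  · refine (ProbabilityTheory.differentiableOn_complexMGF (X := id) (μ := μ)).comp (by fun_prop) ?_
    have : Ioo 0 β ⊆ interior (ProbabilityTheory.integrableExpSet id μ) := by
      rw [isOpen_Ioo.subset_interior_iff]
      intro t ht
      exact mono_aux μ β t ht.1.le ht.2.le h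
    intro z hz
    exact this (by simpa using hz)
  · have := cont_aux μ {s : ℂ | 0 ≤ s.re ∧ s.re ≤ β} (fun x => 1 + Real.exp (β * x))
      ((integrable_const (1:ℝ)).add h) (fun s hs => by
        filter_upwards with x using half_bound β x s.re hs.1 hs.2)
    refine this.comp (by fun_prop) ?_
    intro z hz
    simpa using hz
  · intro t
    simp [ProbabilityTheory.complexMGF]


end Aux

/-- Sublemma: for a finite Borel measure `μ` on `ℝ` and `β > 0`, the function `λ ↦ e^{βλ}`
is `μ`-integrable iff the Fourier transform `μ̂(t) = ∫ e^{-itλ} dμ(λ)` is the boundary value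
of a function holomorphic in the strip `{0 < Im z < β}` and continuous on its closure.
Moreover, any such function is automatically bounded on the closed strip. -/
theorem exp_integrable_iff_fourier_extends_holomorphically
    (μ : Measure ℝ) [IsFiniteMeasure μ] (β : ℝ) (hβ : 0 < β) :
    ((Integrable (fun x : ℝ => Real.exp (β * x)) μ) ↔
      ∃ F : ℂ → ℂ,
        DifferentiableOn ℂ F {z : ℂ | 0 < z.im ∧ z.im < β} ∧
        ContinuousOn F {z : ℂ | 0 ≤ z.im ∧ z.im ≤ β} ∧
        (∀ t : ℝ, F t = ∫ x : ℝ, Complex.exp (-(Complex.I * t * x)) ∂μ)) ∧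
    (∀ F : ℂ → ℂ,
      DifferentiableOn ℂ F {z : ℂ | 0 < z.im ∧ z.im < β} →
      ContinuousOn F {z : ℂ | 0 ≤ z.im ∧ z.im ≤ β} →
      (∀ t : ℝ, F t = ∫ x : ℝ, Complex.exp (-(Complex.I * t * x)) ∂μ) →
      ∃ C : ℝ, ∀ z ∈ {z : ℂ | 0 ≤ z.im ∧ z.im ≤ β}, ‖F z‖ ≤ C) := by
  refine ⟨⟨fun h => forward_aux μ β h, ?_⟩, ?_⟩
  · rintro ⟨F, h1, h2, h3⟩
    exact (core_aux μ β hβ F h1 h2 h3).1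
  · intro F h1 h2 h3
    exact (core_aux μ β hβ F h1 h2 h3).2
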